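/- arXiv:1407.7140 — 5 statements merged into one kernel-verified Lean document; each statement's English description precedes it below -/
import Mathlib

section
/- Let I ≥ 2 be an integer, let v̲ < v̄, and let F : ℝ → ℝ be continuous and nondecreasing with F(v̲) = 0 and F(v) > 0 on (v̲, v̄], and suppose F is differentiable on (v̲, v̄) with strictly positive derivative f there. Then the equilibrium strategy s(v) = v − F(v)^{−(I−1)} ∫_{v̲}^{v} F(u)^{I−1} du is strictly increasing on (v̲, v̄]; i.e., bids are a strictly increasing function of private values. -/
/-- A point minus the ratio `(∫ G) / G` there is strictly increasing when `G` is continuous,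
positive and strictly increasing. -/
theorem strictMonoOn_sub_inv_mul_integral {G : ℝ → ℝ} {lo hi : ℝ} (hcont : Continuous G)
    (hpos : ∀ v ∈ Set.Ioc lo hi, 0 < G v) (hmono : StrictMonoOn G (Set.Ioc lo hi)) :
    StrictMonoOn (fun v => v - (G v)⁻¹ * ∫ u in lo..v, G u) (Set.Ioc lo hi) := by
  intro a ha b hb hab
  have hint (x y : ℝ) : IntervalIntegrable G MeasureTheory.volume x y :=
    hcont.intervalIntegrable x y
  have hA : 0 < ∫ u in lo..a, G u :=
    intervalIntegral.intervalIntegral_pos_of_pos_on (hint lo a)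
      (fun u hu => hpos u ⟨hu.1, hu.2.le.trans ha.2⟩) ha.1
  have hB : ∫ u in a..b, G u ≤ (b - a) * G b := by
    simpa using intervalIntegral.integral_mono_on hab.le (hint a b)
      (intervalIntegrable_const (c := G b))
      fun u hu => hmono.monotoneOn ⟨ha.1.trans_le hu.1, hu.2.trans hb.2⟩ hb hu.2
  have hinv : (G b)⁻¹ < (G a)⁻¹ := inv_strictAnti₀ (hpos a ha) (hmono ha hb hab)
  have hB' : (G b)⁻¹ * ∫ u in a..b, G u ≤ b - a := by
    rw [inv_mul_le_iff₀ (hpos b hb)]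
    linarith
  have hA' := mul_lt_mul_of_pos_right hinv hA
  change a - (G a)⁻¹ * _ < b - (G b)⁻¹ * _
  rw [← intervalIntegral.integral_add_adjacent_intervals (hint lo a) (hint a b), mul_add]
  linarith


/-- If `F` is differentiable on `(v̲, v̄)` with strictly positive
derivative `f` there, the equilibrium strategy
`s v = v - F(v)^{-(I-1)} ∫_{v̲}^{v} F(u)^{I-1} du` is strictly increasing on `(v̲, v̄]`. -/
theorem equilibrium_strategy_strictMonoOn
    (I : ℕ) (hI : 2 ≤ I) (vlo vhi : ℝ) (hv : vlo < vhi)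
    (F : ℝ → ℝ) (hFcont : Continuous F) (hFmono : Monotone F)
    (hFlo : F vlo = 0) (hFpos : ∀ v ∈ Set.Ioc vlo vhi, 0 < F v)
    (f : ℝ → ℝ) (hf : ∀ v ∈ Set.Ioo vlo vhi, HasDerivAt F (f v) v)
    (hfpos : ∀ v ∈ Set.Ioo vlo vhi, 0 < f v)
    (s : ℝ → ℝ)
    (hs : ∀ v ∈ Set.Ioc vlo vhi,
      s v = v - (F v ^ (I - 1))⁻¹ * ∫ u in vlo..v, F u ^ (I - 1)) :
    StrictMonoOn s (Set.Ioc vlo vhi) := by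
  have hF : StrictMonoOn F (Set.Icc vlo vhi) := by
    refine strictMonoOn_of_deriv_pos (convex_Icc vlo vhi) hFcont.continuousOn fun v hv => ?_
    rw [interior_Icc] at hv
    rw [(hf v hv).deriv]
    exact hfpos v hv
  refine StrictMonoOn.congr (f₁ := fun v => v - (F v ^ (I - 1))⁻¹ * ∫ u in vlo..v, F u ^ (I - 1))
    ?_ fun v hv => (hs v hv).symm
  refine strictMonoOn_sub_inv_mul_integral (hFcont.pow _) (fun v hv => pow_pos (hFpos v hv) _) ?_
  intro a ha b hb hab
  exact pow_lt_pow_left₀ (hF (Set.Ioc_subset_Icc_self ha) (Set.Ioc_subset_Icc_self hb) hab)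
    (hFpos a ha).le (by lia)
end

section
/- Let I ≥ 2 be an integer, let v̲ < v̄, and let F : ℝ → ℝ be continuous and nondecreasing with F(v̲) = 0 and F(v) > 0 on (v̲, v̄], continuously differentiable on (v̲, v̄) with strictly positive derivative f. Let s be the equilibrium strategy, which is then strictly increasing on (v̲, v̄) with image an interval J; let ξ : J → (v̲, v̄) be the inverse of s and let G = F ∘ ξ (the bid distribution function). Then G is differentiable on J with derivative g(b) > 0 for every b ∈ J, and the GPV inverse-bidding identity holds: ξ(b) = b + (1/(I−1)) · G(b)/g(b) for every b ∈ J. -/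
/-- The bid-shading strategy `v - A v / F v ^ n`, where `A` is the integral of `F ^ n`, has strict
derivative `n * f v / F v * (v - s v)`. -/
theorem hasStrictDerivAt_sub_inv_pow_mul_integral {F : ℝ → ℝ} (hF : Continuous F) {f' a v : ℝ}
    (hf : HasStrictDerivAt F f' v) (hFv : F v ≠ 0) (n : ℕ) :
    HasStrictDerivAt (fun w => w - (F w ^ n)⁻¹ * ∫ u in a..w, F u ^ n)
      (n * f' / F v * ((F v ^ n)⁻¹ * ∫ u in a..v, F u ^ n)) v := by
  have hc : Continuous fun u => F u ^ n := hF.pow n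
  have hA : HasStrictDerivAt (fun w => ∫ u in a..w, F u ^ n) (F v ^ n) v :=
    intervalIntegral.integral_hasStrictDerivAt_right (hc.intervalIntegrable _ _)
      (hc.stronglyMeasurableAtFilter _ _) hc.continuousAt
  have hpow : HasStrictDerivAt (fun w => (F w ^ n)⁻¹)
      (-((F v ^ n) ^ 2)⁻¹ * (n * F v ^ (n - 1) * f')) v :=
    (hasStrictDerivAt_inv (pow_ne_zero n hFv)).comp v
      ((hasStrictDerivAt_pow n (F v)).comp v hf)
  refine ((hasStrictDerivAt_id v).sub (hpow.mul hA)).congr_deriv ?_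
  rcases n with _ | n
  · simp
  · simp only [Nat.add_sub_cancel]
    field_simp
    ring


/-- GPV inverse-bidding identity: if `F` is continuously differentiable
on `(v̲, v̄)` with strictly positive derivative `f`, the equilibrium strategy `s` is
strictly increasing on `(v̲, v̄)` with image an interval `J = s '' (v̲, v̄)`; its inverse
`ξ` and the bid distribution `G = F ∘ ξ` satisfy: `G` is differentiable on `J` with
derivative `g(b) > 0`, and `ξ(b) = b + (1/(I-1)) G(b)/g(b)` for every `b ∈ J`. -/
theorem gpv_inverse_bidding_identity
    (I : ℕ) (hI : 2 ≤ I) (vlo vhi : ℝ) (hv : vlo < vhi)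
    (F : ℝ → ℝ) (hFcont : Continuous F) (hFmono : Monotone F)
    (hFlo : F vlo = 0) (hFpos : ∀ v ∈ Set.Ioc vlo vhi, 0 < F v)
    (f : ℝ → ℝ) (hf : ∀ v ∈ Set.Ioo vlo vhi, HasDerivAt F (f v) v)
    (hfpos : ∀ v ∈ Set.Ioo vlo vhi, 0 < f v)
    (hfcont : ContinuousOn f (Set.Ioo vlo vhi))
    (s : ℝ → ℝ)
    (hs : ∀ v ∈ Set.Ioc vlo vhi,
      s v = v - (F v ^ (I - 1))⁻¹ * ∫ u in vlo..v, F u ^ (I - 1))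
    (ξ : ℝ → ℝ) (hξ : ∀ v ∈ Set.Ioo vlo vhi, ξ (s v) = v) :
    StrictMonoOn s (Set.Ioo vlo vhi) ∧
    ∃ g : ℝ → ℝ, ∀ b ∈ s '' Set.Ioo vlo vhi,
      HasDerivAt (fun t => F (ξ t)) (g b) b ∧ 0 < g b ∧
      ξ b = b + (1 / ((I : ℝ) - 1)) * (F (ξ b) / g b) := by
  obtain ⟨n, rfl⟩ : ∃ n, I = n + 1 := ⟨I - 1, by omega⟩
  have hn : (0 : ℝ) < n := by exact_mod_cast (by omega : 0 < n)
  simp only [Nat.add_sub_cancel] at hs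
  have hshade : ∀ v ∈ Set.Ioo vlo vhi, 0 < v - s v := fun v hv => by
    have hA : 0 < ∫ u in vlo..v, F u ^ n :=
      intervalIntegral.intervalIntegral_pos_of_pos_on ((hFcont.pow n).intervalIntegrable _ _)
        (fun u hu => pow_pos (hFpos u ⟨hu.1, (hu.2.trans hv.2).le⟩) n) hv.1
    have hFv := hFpos v ⟨hv.1, hv.2.le⟩
    rw [hs v ⟨hv.1, hv.2.le⟩, sub_sub_cancel]
    positivity
  have hderiv : ∀ v ∈ Set.Ioo vlo vhi, HasStrictDerivAt s (n * f v / F v * (v - s v)) v :=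
    fun v hv => by
      have hnhds : Set.Ioo vlo vhi ∈ nhds v := isOpen_Ioo.mem_nhds hv
      have hFv : HasStrictDerivAt F (f v) v :=
        hasStrictDerivAt_of_hasDerivAt_of_continuousAt
          (Filter.mem_of_superset hnhds hf) (hfcont.continuousAt hnhds)
      have h := hasStrictDerivAt_sub_inv_pow_mul_integral (a := vlo) hFcont hFv
        (hFpos v ⟨hv.1, hv.2.le⟩).ne' n
      rw [hs v ⟨hv.1, hv.2.le⟩, sub_sub_cancel]
      exact h.congr_of_eventuallyEq
        (Filter.mem_of_superset hnhds fun w hw => (hs w ⟨hw.1, hw.2.le⟩).symm)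
  have hpos : ∀ v ∈ Set.Ioo vlo vhi, 0 < n * f v / F v * (v - s v) := fun v hv =>
    mul_pos (div_pos (mul_pos hn (hfpos v hv)) (hFpos v ⟨hv.1, hv.2.le⟩)) (hshade v hv)
  refine ⟨strictMonoOn_of_deriv_pos (convex_Ioo _ _)
    (fun v hv => (hderiv v hv).hasDerivAt.continuousAt.continuousWithinAt) fun v hv => ?_,
    fun b => F (ξ b) / (n * (ξ b - b)), ?_⟩
  · rw [interior_Ioo] at hv
    rw [(hderiv v hv).hasDerivAt.deriv]
    exact hpos v hv
  rintro _ ⟨v, hv, rfl⟩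
  have hFv := hFpos v ⟨hv.1, hv.2.le⟩
  have hfv := hfpos v hv
  have hsv := hshade v hv
  have hξderiv := ((hderiv v hv).to_local_left_inverse (hpos v hv).ne'
    (Filter.mem_of_superset (isOpen_Ioo.mem_nhds hv) hξ)).hasDerivAt
  have hFξ : HasDerivAt F (f v) (ξ (s v)) := by rw [hξ v hv]; exact hf v hv
  simp only [hξ v hv]
  refine ⟨(hFξ.comp (s v) hξderiv).congr_deriv ?_, by positivity, ?_⟩
  · field_simp
  · push_cast
    rw [add_sub_cancel_right]
    field_simp
    ring
end

section
/- Let I ≥ 2 be an integer, let v̲ < v̄, and let F : ℝ → ℝ be continuous and nondecreasing with F(v̲) = 0 and F(v) > 0 on (v̲, v̄], differentiable on (v̲, v̄) with derivative f. Let s be the equilibrium strategy. Suppose β : (v̲, v̄) → ℝ is differentiable and satisfies the first-order condition F(v) β′(v) = (I−1) f(v) (v − β(v)) for all v ∈ (v̲, v̄), together with the boundary condition β(v) → v̲ as v → v̲ from the right. Then β(v) = s(v) for every v ∈ (v̲, v̄); i.e., s is the unique solution of the Bayesian-Nash first-order differential equation with boundary condition s(v̲) = v̲. -/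
/-- A function with zero derivative on `(a, b)` that tends to `c` at `a` from the right is
equal to `c` on `(a, b)`. -/
theorem eq_of_hasDerivAt_zero_of_tendsto_nhdsGT {a b c : ℝ} {g : ℝ → ℝ}
    (hg : ∀ x ∈ Set.Ioo a b, HasDerivAt g 0 x)
    (hlim : Filter.Tendsto g (nhdsWithin a (Set.Ioi a)) (nhds c)) :
    ∀ x ∈ Set.Ioo a b, g x = c := by
  intro x hx
  refine tendsto_nhds_unique (tendsto_const_nhds.congr' ?_) hlim
  filter_upwards [Ioo_mem_nhdsGT (hx.1.trans hx.2)] with y hy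
  exact isOpen_Ioo.is_const_of_deriv_eq_zero isPreconnected_Ioo
    (fun z hz => (hg z hz).differentiableAt.differentiableWithinAt)
    (fun z hz => (hg z hz).deriv) hx hy

/-- Uniqueness of the Bayesian-Nash equilibrium strategy: any
differentiable `β` on `(v̲, v̄)` satisfying the first-order condition
`F(v) β′(v) = (I-1) f(v) (v - β(v))` together with the boundary condition
`β(v) → v̲` as `v → v̲⁺` coincides with the equilibrium strategy
`s v = v - F(v)^{-(I-1)} ∫_{v̲}^{v} F(u)^{I-1} du` on `(v̲, v̄)`. -/
theorem equilibrium_strategy_unique_solution_of_FOC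
    (I : ℕ) (hI : 2 ≤ I) (vlo vhi : ℝ) (hv : vlo < vhi)
    (F : ℝ → ℝ) (hFcont : Continuous F) (hFmono : Monotone F)
    (hFlo : F vlo = 0) (hFpos : ∀ v ∈ Set.Ioc vlo vhi, 0 < F v)
    (f : ℝ → ℝ) (hf : ∀ v ∈ Set.Ioo vlo vhi, HasDerivAt F (f v) v)
    (s : ℝ → ℝ)
    (hs : ∀ v ∈ Set.Ioc vlo vhi,
      s v = v - (F v ^ (I - 1))⁻¹ * ∫ u in vlo..v, F u ^ (I - 1))
    (β : ℝ → ℝ)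
    (hβ : ∀ v ∈ Set.Ioo vlo vhi, ∃ d : ℝ, HasDerivAt β d v ∧
      F v * d = ((I : ℝ) - 1) * f v * (v - β v))
    (hβ0 : Filter.Tendsto β (nhdsWithin vlo (Set.Ioi vlo)) (nhds vlo)) :
    ∀ v ∈ Set.Ioo vlo vhi, β v = s v := by
  obtain ⟨k, rfl⟩ : ∃ k, I = k + 2 := ⟨I - 2, by omega⟩
  simp only [show k + 2 - 1 = k + 1 by omega] at hs
  have hpow : Continuous fun u => F u ^ (k + 1) := hFcont.pow _
  have hint (v : ℝ) :
      HasDerivAt (fun w => ∫ u in vlo..w, F u ^ (k + 1)) (F v ^ (k + 1)) v :=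
    hpow.integral_hasStrictDerivAt vlo v |>.hasDerivAt
  have hderiv : ∀ v ∈ Set.Ioo vlo vhi, HasDerivAt
      (fun w => F w ^ (k + 1) * (β w - w) + ∫ u in vlo..w, F u ^ (k + 1)) 0 v := by
    intro v hvm
    obtain ⟨d, hd, hfoc⟩ := hβ v hvm
    refine ((((hf v hvm).fun_pow (k + 1)).fun_mul (hd.fun_sub (hasDerivAt_id' v))).fun_add
      (hint v)).congr_deriv ?_
    push_cast at hfoc ⊢
    linear_combination F v ^ k * hfoc
  have hlim : Filter.Tendsto
      (fun w => F w ^ (k + 1) * (β w - w) + ∫ u in vlo..w, F u ^ (k + 1))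
      (nhdsWithin vlo (Set.Ioi vlo)) (nhds 0) := by
    have hpow_lim := (hpow.tendsto vlo).mono_left (nhdsWithin_le_nhds (s := Set.Ioi vlo))
    have hint_lim := (hint vlo).continuousAt.tendsto.mono_left
      (nhdsWithin_le_nhds (s := Set.Ioi vlo))
    have hid := (Filter.tendsto_id (x := nhds vlo)).mono_left
      (nhdsWithin_le_nhds (s := Set.Ioi vlo))
    simpa [hFlo] using (hpow_lim.mul (hβ0.sub hid)).add hint_lim
  intro v hvm
  have hFv := (hFpos v ⟨hvm.1, hvm.2.le⟩).ne'
  have hzero := eq_of_hasDerivAt_zero_of_tendsto_nhdsGT hderiv hlim v hvm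
  rw [hs v ⟨hvm.1, hvm.2.le⟩]
  field_simp
  linear_combination hzero
end

section
/- Fix an integer I ≥ 2. For i = 1, 2, let Fᵢ : ℝ → ℝ be a cumulative distribution function of a probability measure μᵢ on ℝ, supported on [v̲ᵢ, v̄ᵢ] with v̲ᵢ < v̄ᵢ, such that Fᵢ is continuous on ℝ, Fᵢ(v̲ᵢ) = 0, Fᵢ(v̄ᵢ) = 1, and Fᵢ is continuously differentiable with strictly positive derivative on (v̲ᵢ, v̄ᵢ). Let sᵢ be the associated equilibrium strategy, extended to v̲ᵢ by sᵢ(v̲ᵢ) = v̲ᵢ. If the pushforward measures coincide, i.e. the image of μ₁ under s₁ equals the image of μ₂ under s₂ (the two auctions generate the same distribution of observed bids), then v̲₁ = v̲₂, v̄₁ = v̄₂, and F₁ = F₂. In other words, the private-value distribution is nonparametrically identified from the distribution of equilibrium bids. -/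
open MeasureTheory

/-- An equilibrium of a symmetric first-price auction with `n + 1` bidders: `F` is the continuous
cdf of the value distribution `μ`, strictly increasing on its support `[lo, hi]`, and `s` is the
equilibrium strategy. -/
structure IsFirstPriceEquilibrium (n : ℕ) (μ : Measure ℝ) (lo hi : ℝ) (F s : ℝ → ℝ) : Prop where
  n_ne_zero : n ≠ 0
  isProbabilityMeasure : IsProbabilityMeasure μ
  lo_lt_hi : lo < hi
  cdf_eq : ∀ x, F x = μ.real (Set.Iic x)
  measure_Icc : μ (Set.Icc lo hi) = 1
  continuous : Continuous F
  cdf_lo : F lo = 0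
  cdf_hi : F hi = 1
  strictMonoOn : StrictMonoOn F (Set.Icc lo hi)
  strategy_eq : ∀ v ∈ Set.Ioc lo hi, s v = v - (F v ^ n)⁻¹ * ∫ u in lo..v, F u ^ n

namespace IsFirstPriceEquilibrium

variable {n : ℕ} {μ ν : Measure ℝ} {lo hi lo' hi' : ℝ} {F s G t : ℝ → ℝ}

lemma cdf_nonneg (h : IsFirstPriceEquilibrium n μ lo hi F s) (x : ℝ) : 0 ≤ F x := by
  rw [h.cdf_eq]
  exact measureReal_nonneg

lemma cdf_le_one (h : IsFirstPriceEquilibrium n μ lo hi F s) (x : ℝ) : F x ≤ 1 := by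
  have := h.isProbabilityMeasure
  rw [h.cdf_eq]
  exact measureReal_le_one

lemma monotone_cdf (h : IsFirstPriceEquilibrium n μ lo hi F s) : Monotone F := by
  have := h.isProbabilityMeasure
  intro x y hxy
  rw [h.cdf_eq, h.cdf_eq]
  exact measureReal_mono (Set.Iic_subset_Iic.2 hxy)

lemma monotone_cdf_pow (h : IsFirstPriceEquilibrium n μ lo hi F s) :
    Monotone fun x => F x ^ n := fun x _ hxy =>
  pow_le_pow_left₀ (h.cdf_nonneg x) (h.monotone_cdf hxy) n

lemma cdf_pos_iff (h : IsFirstPriceEquilibrium n μ lo hi F s) {x : ℝ} : 0 < F x ↔ lo < x := by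
  constructor
  · intro hx
    by_contra! hle
    exact absurd (h.monotone_cdf hle) (by rw [h.cdf_lo]; exact not_le.2 hx)
  · intro hx
    have hm := h.strictMonoOn (Set.left_mem_Icc.2 h.lo_lt_hi.le)
      ⟨(lt_min hx h.lo_lt_hi).le, min_le_right x hi⟩ (lt_min hx h.lo_lt_hi)
    rw [h.cdf_lo] at hm
    exact hm.trans_le (h.monotone_cdf (min_le_left x hi))

lemma cdf_lt_one_iff (h : IsFirstPriceEquilibrium n μ lo hi F s) {x : ℝ} : F x < 1 ↔ x < hi := by
  constructor
  · intro hx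
    by_contra! hle
    exact absurd (h.monotone_cdf hle) (by rw [h.cdf_hi]; exact not_le.2 hx)
  · intro hx
    have hm := h.strictMonoOn ⟨le_max_right x lo, (max_lt hx h.lo_lt_hi).le⟩
      (Set.right_mem_Icc.2 h.lo_lt_hi.le) (max_lt hx h.lo_lt_hi)
    rw [h.cdf_hi] at hm
    exact (h.monotone_cdf (le_max_left x lo)).trans_lt hm

lemma exists_cdf_eq (h : IsFirstPriceEquilibrium n μ lo hi F s) {p : ℝ} (hp : 0 < p)
    (hp1 : p ≤ 1) : ∃ v ∈ Set.Ioc lo hi, F v = p := by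
  obtain ⟨v, hv, rfl⟩ := intermediate_value_Icc h.lo_lt_hi.le h.continuous.continuousOn
    (show p ∈ Set.Icc (F lo) (F hi) by rw [h.cdf_lo, h.cdf_hi]; exact ⟨hp.le, hp1⟩)
  exact ⟨v, ⟨h.cdf_pos_iff.1 hp, hv.2⟩, rfl⟩

lemma cdf_pow_pos (h : IsFirstPriceEquilibrium n μ lo hi F s) {v : ℝ} (hv : lo < v) :
    0 < F v ^ n :=
  pow_pos (h.cdf_pos_iff.2 hv) n

lemma intervalIntegrable (h : IsFirstPriceEquilibrium n μ lo hi F s) (a b : ℝ) :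
    IntervalIntegrable (fun u => F u ^ n) volume a b :=
  (h.continuous.pow n).intervalIntegrable a b

lemma strategy_mul_cdf_pow (h : IsFirstPriceEquilibrium n μ lo hi F s) {v : ℝ}
    (hv : v ∈ Set.Ioc lo hi) : s v * F v ^ n = v * F v ^ n - ∫ u in lo..v, F u ^ n := by
  rw [h.strategy_eq v hv, sub_mul, mul_right_comm, inv_mul_cancel₀ (h.cdf_pow_pos hv.1).ne',
    one_mul]

/-- As a function of the winning probability, the expected payment is convex and has the value
itself as a subgradient. -/
lemma value_mul_sub_le (h : IsFirstPriceEquilibrium n μ lo hi F s) {v w : ℝ}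
    (hv : v ∈ Set.Ioc lo hi) (hw : w ∈ Set.Ioc lo hi) :
    v * (F w ^ n - F v ^ n) ≤ s w * F w ^ n - s v * F v ^ n := by
  rw [h.strategy_mul_cdf_pow hv, h.strategy_mul_cdf_pow hw]
  have hadd := intervalIntegral.integral_add_adjacent_intervals
    (h.intervalIntegrable lo v) (h.intervalIntegrable v w)
  have key : ∫ u in v..w, F u ^ n ≤ (w - v) * F w ^ n := by
    rcases le_total v w with hvw | hvw
    · have := intervalIntegral.integral_mono_on hvw (h.intervalIntegrable v w)
        (intervalIntegrable_const (c := F w ^ n)) fun u hu => h.monotone_cdf_pow hu.2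
      simpa using this
    · have := intervalIntegral.integral_mono_on hvw (intervalIntegrable_const (c := F w ^ n))
        (h.intervalIntegrable w v) fun u hu => h.monotone_cdf_pow hu.1
      rw [intervalIntegral.integral_symm]
      simp only [intervalIntegral.integral_const, smul_eq_mul] at this
      linarith
  linarith

lemma strategy_lt (h : IsFirstPriceEquilibrium n μ lo hi F s) {v : ℝ} (hv : v ∈ Set.Ioc lo hi) :
    s v < v := by
  have hint : 0 < ∫ u in lo..v, F u ^ n :=
    intervalIntegral.intervalIntegral_pos_of_pos_on (h.intervalIntegrable lo v)
      (fun u hu => h.cdf_pow_pos hu.1) hv.1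
  rw [h.strategy_eq v hv]
  exact sub_lt_self v (mul_pos (inv_pos.2 (h.cdf_pow_pos hv.1)) hint)

lemma strictMonoOn_strategy (h : IsFirstPriceEquilibrium n μ lo hi F s) :
    StrictMonoOn s (Set.Ioc lo hi) := by
  intro v hv w hw hvw
  have hq : F v ^ n < F w ^ n :=
    pow_lt_pow_left₀ (h.strictMonoOn (Set.Ioc_subset_Icc_self hv) (Set.Ioc_subset_Icc_self hw) hvw)
      (h.cdf_nonneg v) h.n_ne_zero
  have hsub := h.value_mul_sub_le hv hw
  have hlt := mul_lt_mul_of_pos_right (h.strategy_lt hv) (sub_pos.2 hq)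
  refine lt_of_mul_lt_mul_right ?_ (h.cdf_pow_pos hw.1).le
  linarith

lemma continuousOn_strategy (h : IsFirstPriceEquilibrium n μ lo hi F s) :
    ContinuousOn s (Set.Ioc lo hi) := by
  refine ContinuousOn.congr ?_ h.strategy_eq
  refine continuousOn_id.sub (ContinuousOn.mul ?_ ?_)
  · exact (h.continuous.pow n).continuousOn.inv₀ fun v hv => (h.cdf_pow_pos hv.1).ne'
  · exact (intervalIntegral.continuous_primitive h.intervalIntegrable lo).continuousOn

lemma ae_mem_Ioc (h : IsFirstPriceEquilibrium n μ lo hi F s) : ∀ᵐ v ∂μ, v ∈ Set.Ioc lo hi := by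
  have := h.isProbabilityMeasure
  have hlo : ∀ᵐ v ∂μ, v ∉ Set.Iic lo := by
    rw [← measure_eq_zero_iff_ae_notMem, ← measureReal_eq_zero_iff, ← h.cdf_eq, h.cdf_lo]
  have hIcc : ∀ᵐ v ∂μ, v ∈ Set.Icc lo hi :=
    (mem_ae_iff_prob_eq_one measurableSet_Icc).2 h.measure_Icc
  filter_upwards [hlo, hIcc] with v hv hv'
  exact ⟨not_le.1 hv, hv'.2⟩

lemma aemeasurable_strategy (h : IsFirstPriceEquilibrium n μ lo hi F s) : AEMeasurable s μ := by
  rw [← Measure.restrict_eq_self_of_ae_mem h.ae_mem_Ioc]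
  exact aemeasurable_restrict_of_monotoneOn measurableSet_Ioc h.strictMonoOn_strategy.monotoneOn

lemma map_real_Iic_strategy (h : IsFirstPriceEquilibrium n μ lo hi F s) {v : ℝ}
    (hv : v ∈ Set.Ioc lo hi) : (μ.map s).real (Set.Iic (s v)) = F v := by
  rw [h.cdf_eq, map_measureReal_apply_of_aemeasurable h.aemeasurable_strategy measurableSet_Iic]
  refine measureReal_congr ?_
  filter_upwards [h.ae_mem_Ioc] with u hu
  exact propext (h.strictMonoOn_strategy.le_iff_le hu hv)

/-- Two equilibria with the same bid distribution have the same bid quantiles. -/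
lemma strategy_le_of_cdf_eq (h : IsFirstPriceEquilibrium n μ lo hi F s)
    (k : IsFirstPriceEquilibrium n ν lo' hi' G t) (hmap : μ.map s = ν.map t) {v w : ℝ}
    (hv : v ∈ Set.Ioc lo hi) (hw : w ∈ Set.Ioc lo' hi') (hvw : F v = G w) : s v ≤ t w := by
  have := h.isProbabilityMeasure
  have := Measure.isProbabilityMeasure_map h.aemeasurable_strategy
  by_contra! hlt
  have hcont : ContinuousWithinAt s (Set.Ioo lo v) v :=
    (h.continuousOn_strategy v hv).mono fun u hu => ⟨hu.1, hu.2.le.trans hv.2⟩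
  have hne : (nhdsWithin v (Set.Ioo lo v)).NeBot := by
    rw [← mem_closure_iff_nhdsWithin_neBot, closure_Ioo hv.1.ne]
    exact Set.right_mem_Icc.2 hv.1.le
  obtain ⟨u, htu, hu⟩ :=
    ((hcont.eventually (lt_mem_nhds hlt)).and self_mem_nhdsWithin).exists
  have hu' : u ∈ Set.Ioc lo hi := ⟨hu.1, hu.2.le.trans hv.2⟩
  have hle : G w ≤ F u := by
    rw [← h.map_real_Iic_strategy hu', ← k.map_real_Iic_strategy hw, ← hmap]
    exact measureReal_mono (Set.Iic_subset_Iic.2 htu.le)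
  have hFu := h.strictMonoOn (Set.Ioc_subset_Icc_self hu') (Set.Ioc_subset_Icc_self hv) hu.2
  linarith

lemma strategy_eq_of_cdf_eq (h : IsFirstPriceEquilibrium n μ lo hi F s)
    (k : IsFirstPriceEquilibrium n ν lo' hi' G t) (hmap : μ.map s = ν.map t) {v w : ℝ}
    (hv : v ∈ Set.Ioc lo hi) (hw : w ∈ Set.Ioc lo' hi') (hvw : F v = G w) : s v = t w :=
  (h.strategy_le_of_cdf_eq k hmap hv hw hvw).antisymm
    (k.strategy_le_of_cdf_eq h hmap.symm hw hv hvw.symm)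

lemma le_of_cdf_lt (h : IsFirstPriceEquilibrium n μ lo hi F s)
    (k : IsFirstPriceEquilibrium n ν lo' hi' G t) (hmap : μ.map s = ν.map t) {v w : ℝ}
    (hv : v ∈ Set.Ioc lo hi) (hw : w ∈ Set.Ioc lo' hi') (hvw : F v < G w) : v ≤ w := by
  obtain ⟨v', hv', hv'eq⟩ := k.exists_cdf_eq (h.cdf_pos_iff.2 hv.1) (h.cdf_le_one v)
  obtain ⟨w', hw', hw'eq⟩ := h.exists_cdf_eq (k.cdf_pos_iff.2 hw.1) (k.cdf_le_one w)
  have hq : F v ^ n < G w ^ n := pow_lt_pow_left₀ hvw (h.cdf_nonneg v) h.n_ne_zero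
  have h₁ := h.value_mul_sub_le hv hw'
  have h₂ := k.value_mul_sub_le hw hv'
  rw [hw'eq, h.strategy_eq_of_cdf_eq k hmap hw' hw hw'eq,
    h.strategy_eq_of_cdf_eq k hmap hv hv' hv'eq.symm] at h₁
  rw [hv'eq] at h₂
  refine le_of_mul_le_mul_right ?_ (sub_pos.2 hq)
  linarith

lemma cdf_le (h : IsFirstPriceEquilibrium n μ lo hi F s)
    (k : IsFirstPriceEquilibrium n ν lo' hi' G t) (hmap : μ.map s = ν.map t) (x : ℝ) :
    F x ≤ G x := by
  by_contra! hlt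
  have hlo : lo < x := h.cdf_pos_iff.1 ((k.cdf_nonneg x).trans_lt hlt)
  have hhi : max x lo' < hi' :=
    max_lt (k.cdf_lt_one_iff.1 (hlt.trans_le (h.cdf_le_one x))) k.lo_lt_hi
  have hF : F (min x hi) = F x := by
    rw [h.monotone_cdf.map_min, h.cdf_hi, min_eq_left (h.cdf_le_one x)]
  have hG : G (max x lo') = G x := by
    rw [k.monotone_cdf.map_max, k.cdf_lo, max_eq_left (k.cdf_nonneg x)]
  have hev : ∀ᶠ w in nhdsWithin (max x lo') (Set.Ioi (max x lo')), G w < F x :=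
    k.continuous.continuousWithinAt.eventually (gt_mem_nhds (by rwa [hG]))
  obtain ⟨w, hGw, hw⟩ := (hev.and (Ioo_mem_nhdsGT hhi)).exists
  have hwv := k.le_of_cdf_lt h hmap.symm (v := w) (w := min x hi)
    ⟨(le_max_right x lo').trans_lt hw.1, hw.2.le⟩
    ⟨lt_min hlo h.lo_lt_hi, min_le_right x hi⟩ (by rwa [hF])
  exact absurd ((le_max_left x lo').trans_lt hw.1) (not_lt.2 (hwv.trans (min_le_left x hi)))

/-- The bid distribution determines the value distribution and its support. -/
theorem identified (h : IsFirstPriceEquilibrium n μ lo hi F s)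
    (k : IsFirstPriceEquilibrium n ν lo' hi' G t) (hmap : μ.map s = ν.map t) :
    lo = lo' ∧ hi = hi' ∧ F = G := by
  obtain rfl : F = G :=
    funext fun x => (h.cdf_le k hmap x).antisymm (k.cdf_le h hmap.symm x)
  exact ⟨eq_of_forall_gt_iff fun x => h.cdf_pos_iff.symm.trans k.cdf_pos_iff,
    eq_of_forall_lt_iff fun x => h.cdf_lt_one_iff.symm.trans k.cdf_lt_one_iff, rfl⟩

end IsFirstPriceEquilibrium

/-- Nonparametric identification: two symmetric IPV first-price
auctions with `I ≥ 2` bidders whose value distributions are smooth cdfs supported on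
`[v̲ᵢ, v̄ᵢ]` generate the same distribution of equilibrium bids (pushforward of the
value distribution under the equilibrium strategy) only if the supports and the value
distributions coincide. -/
theorem value_distribution_identified_from_bids
    (I : ℕ) (hI : 2 ≤ I)
    (μ : Fin 2 → Measure ℝ) (hprob : ∀ i, IsProbabilityMeasure (μ i))
    (vlo vhi : Fin 2 → ℝ) (hv : ∀ i, vlo i < vhi i)
    (F : Fin 2 → ℝ → ℝ)
    (hcdf : ∀ i x, F i x = ((μ i) (Set.Iic x)).toReal)
    (hsupp : ∀ i, μ i (Set.Icc (vlo i) (vhi i)) = 1)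
    (hFcont : ∀ i, Continuous (F i))
    (hF0 : ∀ i, F i (vlo i) = 0) (hF1 : ∀ i, F i (vhi i) = 1)
    (f : Fin 2 → ℝ → ℝ)
    (hderiv : ∀ i, ∀ v ∈ Set.Ioo (vlo i) (vhi i), HasDerivAt (F i) (f i v) v)
    (hfpos : ∀ i, ∀ v ∈ Set.Ioo (vlo i) (vhi i), 0 < f i v)
    (hfcont : ∀ i, ContinuousOn (f i) (Set.Ioo (vlo i) (vhi i)))
    (s : Fin 2 → ℝ → ℝ)
    (hs : ∀ i, ∀ v ∈ Set.Ioc (vlo i) (vhi i),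
      s i v = v - (F i v ^ (I - 1))⁻¹ * ∫ u in (vlo i)..v, F i u ^ (I - 1))
    (hs0 : ∀ i, s i (vlo i) = vlo i)
    (hpush : (μ 0).map (s 0) = (μ 1).map (s 1)) :
    vlo 0 = vlo 1 ∧ vhi 0 = vhi 1 ∧ F 0 = F 1 := by
  have key (i : Fin 2) :
      IsFirstPriceEquilibrium (I - 1) (μ i) (vlo i) (vhi i) (F i) (s i) :=
    { n_ne_zero := by omega
      isProbabilityMeasure := hprob i
      lo_lt_hi := hv i
      cdf_eq := hcdf i
      measure_Icc := hsupp i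
      continuous := hFcont i
      cdf_lo := hF0 i
      cdf_hi := hF1 i
      strictMonoOn := by
        refine strictMonoOn_of_deriv_pos (convex_Icc _ _) (hFcont i).continuousOn fun v hvI => ?_
        rw [interior_Icc] at hvI
        rw [(hderiv i v hvI).deriv]
        exact hfpos i v hvI
      strategy_eq := hs i }
  exact (key 0).identified (key 1) hpush
end

section
/- Let I ≥ 2 be an integer, let ṽ̲ < ṽ̄, let F̃ : ℝ → ℝ be continuous and nondecreasing with F̃(ṽ̲) = 0 and F̃(v) > 0 for v ∈ (ṽ̲, ṽ̄], and let u > 0 be a real number. Define F(x) = F̃(x/u) (the distribution of the scaled value Ṽ·u). Then the equilibrium strategies satisfy the multiplicative-separability identity s_F(v) = u · s_{F̃}(v/u) for every v ∈ (u·ṽ̲, u·ṽ̄], where s_F is the equilibrium strategy for distribution F on [u·ṽ̲, u·ṽ̄] and s_{F̃} that for F̃ on [ṽ̲, ṽ̄]. Consequently, with multiplicative unobserved heterogeneity V = Ṽ·u, equilibrium bids satisfy B = B̃·u. -/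
/-- Multiplicative separability under unobserved heterogeneity
(Krasnokutskaya 2011): if `F(x) = F̃(x/u)` with `u > 0` is the distribution of the
scaled value `Ṽ·u`, then the equilibrium strategies satisfy
`s_F(v) = u · s_{F̃}(v/u)` for every `v ∈ (u·ṽ̲, u·ṽ̄]`; consequently equilibrium
bids satisfy `B = B̃·u`. -/
theorem equilibrium_strategy_multiplicative_separability
    (I : ℕ) (hI : 2 ≤ I) (tlo thi : ℝ) (ht : tlo < thi)
    (Ft : ℝ → ℝ) (hFtcont : Continuous Ft) (hFtmono : Monotone Ft)
    (hFt0 : Ft tlo = 0) (hFtpos : ∀ v ∈ Set.Ioc tlo thi, 0 < Ft v)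
    (u : ℝ) (hu : 0 < u)
    (F : ℝ → ℝ) (hF : ∀ x, F x = Ft (x / u))
    (sF sFt : ℝ → ℝ)
    (hsFt : ∀ v ∈ Set.Ioc tlo thi,
      sFt v = v - (Ft v ^ (I - 1))⁻¹ * ∫ w in tlo..v, Ft w ^ (I - 1))
    (hsF : ∀ v ∈ Set.Ioc (u * tlo) (u * thi),
      sF v = v - (F v ^ (I - 1))⁻¹ * ∫ w in (u * tlo)..v, F w ^ (I - 1)) :
    ∀ v ∈ Set.Ioc (u * tlo) (u * thi), sF v = u * sFt (v / u) := by
  intro v hv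
  have hvu : v / u ∈ Set.Ioc tlo thi :=
    ⟨(lt_div_iff₀' hu).2 hv.1, (div_le_iff₀' hu).2 hv.2⟩
  rw [hsF v hv, hsFt _ hvu]
  simp only [hF]
  rw [intervalIntegral.integral_comp_div (fun w => Ft w ^ (I - 1)) hu.ne',
    mul_div_cancel_left₀ tlo hu.ne', smul_eq_mul, mul_sub, mul_div_cancel₀ v hu.ne']
  ring
end
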